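/- For all indices h, i, j, k the v-curvature d-tensor satisfies S^{hijk} = ((m−1)(m−2)²/(4K²))·[ ( ∑_r a_r^{ij}a^{rhk} − a^{ij}(a^{hk} − a^h a^k) + a^i a^j a^{hk} ) − ( ∑_r a_r^{ik}a^{rhj} − a^{ik}(a^{hj} − a^h a^j) + a^i a^k a^{hj} ) ]. -/

import Mathlib

open Finset

noncomputable section

/-- `A(p) = ∑ a^{i₁…i_m} p_{i₁}⋯p_{i_m}`, where `m = M + 3 ≥ 3`. -/
def Afun {n M : ℕ} (a : (Fin (M + 3) → Fin n) → ℝ) (p : Fin n → ℝ) : ℝ :=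
  ∑ ι : Fin (M + 3) → Fin n, a ι * ∏ t, p (ι t)

/-- `K(p) = A(p)^{1/m}`. -/
def Kfun {n M : ℕ} (a : (Fin (M + 3) → Fin n) → ℝ) (p : Fin n → ℝ) : ℝ :=
  Afun a p ^ ((1 : ℝ) / (M + 3))

/-- `a^i = (∑ a^{i i₂…i_m} p_{i₂}⋯p_{i_m}) / K^{m-1}`. -/
def aU1 {n M : ℕ} (a : (Fin (M + 3) → Fin n) → ℝ) (i : Fin n) (p : Fin n → ℝ) : ℝ :=
  (∑ ι : Fin (M + 2) → Fin n, a (Fin.cons i ι) * ∏ t, p (ι t)) / Kfun a p ^ (M + 2)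

/-- `a^{ij} = (∑ a^{i j i₃…i_m} p_{i₃}⋯p_{i_m}) / K^{m-2}`. -/
def aU2 {n M : ℕ} (a : (Fin (M + 3) → Fin n) → ℝ) (i j : Fin n) (p : Fin n → ℝ) : ℝ :=
  (∑ ι : Fin (M + 1) → Fin n, a (Fin.cons i (Fin.cons j ι)) * ∏ t, p (ι t)) / Kfun a p ^ (M + 1)

/-- `a^{ijk} = (∑ a^{i j k i₄…i_m} p_{i₄}⋯p_{i_m}) / K^{m-3}`. -/
def aU3 {n M : ℕ} (a : (Fin (M + 3) → Fin n) → ℝ) (i j k : Fin n) (p : Fin n → ℝ) : ℝ :=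
  (∑ ι : Fin M → Fin n, a (Fin.cons i (Fin.cons j (Fin.cons k ι))) * ∏ t, p (ι t)) / Kfun a p ^ M

/-- Partial derivative `∂f/∂p_k` of a function of `p`. -/
def pd {n : ℕ} (f : (Fin n → ℝ) → ℝ) (k : Fin n) (p : Fin n → ℝ) : ℝ :=
  deriv (fun t => f (Function.update p k t)) (p k)

/-- Fundamental metrical d-tensor `g^{ij} = (1/2) ∂²(K²)/∂p_i∂p_j`. -/
def gU {n M : ℕ} (a : (Fin (M + 3) → Fin n) → ℝ) (i j : Fin n) (p : Fin n → ℝ) : ℝ :=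
  (1 / 2 : ℝ) * pd (fun q => pd (fun r => Kfun a r ^ 2) j q) i p

/-- Angular metrical d-tensor `h^{ij} = K ∂²K/∂p_i∂p_j`. -/
def hU {n M : ℕ} (a : (Fin (M + 3) → Fin n) → ℝ) (i j : Fin n) (p : Fin n → ℝ) : ℝ :=
  Kfun a p * pd (fun q => pd (Kfun a) j q) i p

/-- v-torsion d-tensor `C^{ijk} = -(1/2) ∂g^{ij}/∂p_k`. -/
def CU {n M : ℕ} (a : (Fin (M + 3) → Fin n) → ℝ) (i j k : Fin n) (p : Fin n → ℝ) : ℝ :=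
  -(1 / 2 : ℝ) * pd (gU a i j) k p

/-- Symmetry of `a` in all of its `m` indices. -/
def aSym {n M : ℕ} (a : (Fin (M + 3) → Fin n) → ℝ) : Prop :=
  ∀ (σ : Equiv.Perm (Fin (M + 3))) (ι : Fin (M + 3) → Fin n), a (ι ∘ σ) = a ι

/-- `a_i = ∑_s a_{is} a^s`, where `aLow` is the inverse matrix of `(a^{ij})`. -/
def aL {n M : ℕ} (a : (Fin (M + 3) → Fin n) → ℝ) (aLow : Matrix (Fin n) (Fin n) ℝ)
    (p : Fin n → ℝ) (i : Fin n) : ℝ :=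
  ∑ s, aLow i s * aU1 a s p

/-- `a_i^{jk} = ∑_s a_{is} a^{sjk}`. -/
def aL3 {n M : ℕ} (a : (Fin (M + 3) → Fin n) → ℝ) (aLow : Matrix (Fin n) (Fin n) ℝ)
    (p : Fin n → ℝ) (i j k : Fin n) : ℝ :=
  ∑ s, aLow i s * aU3 a s j k p

/-- `g_{ij} = (1/(m-1)) a_{ij} + ((m-2)/(m-1)) a_i a_j`, the inverse of `g^{ij}`. -/
def gL {n M : ℕ} (a : (Fin (M + 3) → Fin n) → ℝ) (aLow : Matrix (Fin n) (Fin n) ℝ)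
    (p : Fin n → ℝ) (i j : Fin n) : ℝ :=
  (1 / (M + 2 : ℝ)) * aLow i j + ((M + 1 : ℝ) / (M + 2)) * aL a aLow p i * aL a aLow p j

/-- v-derivation components `C_i^{jk} = ∑_s g_{is} C^{sjk}`. -/
def CL {n M : ℕ} (a : (Fin (M + 3) → Fin n) → ℝ) (aLow : Matrix (Fin n) (Fin n) ℝ)
    (p : Fin n → ℝ) (i j k : Fin n) : ℝ :=
  ∑ s, gL a aLow p i s * CU a s j k p

/-- v-curvature d-tensor `S^{hijk} = ∑_r (C_r^{ij} C^{rhk} - C_r^{ik} C^{rhj})`. -/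
def Scurv {n M : ℕ} (a : (Fin (M + 3) → Fin n) → ℝ) (aLow : Matrix (Fin n) (Fin n) ℝ)
    (p : Fin n → ℝ) (h i j k : Fin n) : ℝ :=
  ∑ r, (CL a aLow p r i j * CU a r h k p - CL a aLow p r i k * CU a r h j p)

/-- `U^{hijk} = ∑_r (a_r^{ij} a^{rhk} - a_r^{ik} a^{rhj})`. -/
def Ufun {n M : ℕ} (a : (Fin (M + 3) → Fin n) → ℝ) (aLow : Matrix (Fin n) (Fin n) ℝ)
    (p : Fin n → ℝ) (h i j k : Fin n) : ℝ :=
  ∑ r, (aL3 a aLow p r i j * aU3 a r h k p - aL3 a aLow p r i k * aU3 a r h j p)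

/-- General homogeneous form of degree `N`. -/
def FF {n N : ℕ} (b : (Fin N → Fin n) → ℝ) (p : Fin n → ℝ) : ℝ :=
  ∑ ι : Fin N → Fin n, b ι * ∏ t, p (ι t)

/-- Symmetric coefficients of any degree. -/
def SymN {n N : ℕ} (b : (Fin N → Fin n) → ℝ) : Prop :=
  ∀ (σ : Equiv.Perm (Fin N)) (ι : Fin N → Fin n), b (ι ∘ σ) = b ι

theorem FF_succ {n N : ℕ} (b : (Fin (N + 1) → Fin n) → ℝ) (p : Fin n → ℝ) :
    FF b p = ∑ i, p i * FF (fun ι => b (Fin.cons i ι)) p := by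
  unfold FF
  rw [← (Fin.consEquiv (fun _ : Fin (N + 1) => Fin n)).sum_comp, Fintype.sum_prod_type]
  refine Finset.sum_congr rfl fun i _ => ?_
  rw [Finset.mul_sum]
  refine Finset.sum_congr rfl fun ι _ => ?_
  simp only [Fin.consEquiv, Equiv.coe_fn_mk, Fin.prod_univ_succ, Fin.cons_zero, Fin.cons_succ]
  ring

theorem SymN.cons {n N : ℕ} {b : (Fin (N + 1) → Fin n) → ℝ} (hb : SymN b) (i : Fin n) :
    SymN (fun ι => b (Fin.cons i ι)) := by
  intro σ ι
  have h := hb (Equiv.Perm.decomposeFin.symm (0, σ)) (Fin.cons i ι)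
  simp only
  rw [← h]
  congr 1
  funext t
  refine Fin.cases ?_ (fun t => ?_) t
  · simp
  · simp

theorem SymN.swap {n N : ℕ} {b : (Fin (N + 2) → Fin n) → ℝ} (hb : SymN b) (i j : Fin n)
    (ι : Fin N → Fin n) :
    b (Fin.cons i (Fin.cons j ι)) = b (Fin.cons j (Fin.cons i ι)) := by
  rw [← hb (Equiv.swap 0 1) (Fin.cons i (Fin.cons j ι))]
  congr 1
  funext t
  refine Fin.cases ?_ (fun t => ?_) t
  · simp only [Function.comp, Equiv.swap_apply_left, Fin.cons_zero]
    rfl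
  · refine Fin.cases ?_ (fun t => ?_) t
    · have : (Fin.succ 0 : Fin (N + 2)) = 1 := rfl
      simp only [Function.comp, this, Equiv.swap_apply_right, Fin.cons_zero]
      rfl
    · have h0 : (t.succ.succ : Fin (N + 2)) ≠ 0 := Fin.succ_ne_zero _
      have h1 : (t.succ.succ : Fin (N + 2)) ≠ 1 := by
        intro h
        exact Fin.succ_ne_zero t (Fin.succ_injective _ h)
      simp only [Function.comp, Equiv.swap_apply_of_ne_of_ne h0 h1, Fin.cons_succ]

/-- Derivative along a coordinate line. -/
def HP {n : ℕ} (f : (Fin n → ℝ) → ℝ) (k : Fin n) (f' : ℝ) (p : Fin n → ℝ) : Prop :=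
  HasDerivAt (fun t => f (Function.update p k t)) f' (p k)

theorem HP.pd {n : ℕ} {f : (Fin n → ℝ) → ℝ} {k : Fin n} {f' : ℝ} {p : Fin n → ℝ}
    (h : HP f k f' p) : _root_.pd f k p = f' := HasDerivAt.deriv h

theorem HP_coord {n : ℕ} (i k : Fin n) (p : Fin n → ℝ) :
    HP (fun q => q i) k (if i = k then 1 else 0) p := by
  unfold HP
  by_cases h : i = k
  · subst h
    simp only [Function.update_self, if_true]
    exact hasDerivAt_id (p i)
  · simp [h, hasDerivAt_const]

theorem HP_FF {n : ℕ} (k : Fin n) (p : Fin n → ℝ) : ∀ (N : ℕ) (b : (Fin (N + 1) → Fin n) → ℝ),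
    SymN b → HP (FF b) k ((N + 1 : ℝ) * FF (fun ι => b (Fin.cons k ι)) p) p := by
  intro N
  induction N with
  | zero =>
    intro b hb
    have e : FF b = fun q => ∑ i, q i * FF (fun ι => b (Fin.cons i ι)) p := by
      funext q
      rw [FF_succ]
      simp [FF]
    rw [e]
    have := HasDerivAt.fun_sum (u := Finset.univ) (fun i _ =>
      (HP_coord i k p).mul_const (FF (fun ι => b (Fin.cons i ι)) p))
    unfold HP
    simpa using this
  | succ N ih =>
    intro b hb
    have e : FF b = fun q => ∑ i, q i * FF (fun ι => b (Fin.cons i ι)) q := by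
      funext q
      rw [FF_succ]
    rw [e]
    have := HasDerivAt.fun_sum (u := Finset.univ) (fun i _ =>
      (HP_coord i k p).fun_mul (ih (fun ι => b (Fin.cons i ι)) (hb.cons i)))
    unfold HP
    refine this.congr_deriv ?_
    simp only [Function.update_eq_self, Finset.sum_add_distrib, ite_mul, one_mul, zero_mul,
      Finset.sum_ite_eq', Finset.mem_univ, if_true]
    have e2 : FF (fun ι => b (Fin.cons k ι)) p =
        ∑ i, p i * FF (fun ι => b (Fin.cons i (Fin.cons k ι))) p := by
      rw [FF_succ]
      simp only [hb.swap k]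
    have e3 : ∑ i, p i * (((N : ℝ) + 1) * FF (fun ι => b (Fin.cons i (Fin.cons k ι))) p) =
        ((N : ℝ) + 1) * FF (fun ι => b (Fin.cons k ι)) p := by
      rw [e2, Finset.mul_sum]
      exact Finset.sum_congr rfl fun i _ => by ring
    rw [e3]
    push_cast
    ring

theorem Kpos {n M : ℕ} {a : (Fin (M + 3) → Fin n) → ℝ} {p : Fin n → ℝ} (hA : 0 < Afun a p) :
    0 < Kfun a p := Real.rpow_pos_of_pos hA _

theorem Kpow {n M : ℕ} {a : (Fin (M + 3) → Fin n) → ℝ} {p : Fin n → ℝ} (hA : 0 < Afun a p) :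
    Kfun a p ^ (M + 3) = Afun a p := by
  unfold Kfun
  rw [← Real.rpow_natCast, ← Real.rpow_mul hA.le]
  have : (1 : ℝ) / (M + 3) * ((M + 3 : ℕ) : ℝ) = 1 := by
    push_cast
    field_simp
  rw [this, Real.rpow_one]

theorem HP_A {n M : ℕ} {a : (Fin (M + 3) → Fin n) → ℝ} (hs : aSym a) (k : Fin n)
    (p : Fin n → ℝ) :
    HP (Afun a) k ((M + 3 : ℝ) * FF (fun ι => a (Fin.cons k ι)) p) p := by
  have := HP_FF k p (M + 2) a hs
  push_cast at this
  have e : ((M : ℝ) + 2 + 1) = M + 3 := by ring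
  rw [e] at this
  exact this

theorem HP_K {n M : ℕ} {a : (Fin (M + 3) → Fin n) → ℝ} (hs : aSym a) (k : Fin n)
    {p : Fin n → ℝ} (hA : 0 < Afun a p) : HP (Kfun a) k (aU1 a k p) p := by
  have h := HP_A hs k p
  unfold HP at h
  have h2 := h.rpow_const (p := (1 : ℝ) / (M + 3)) (Or.inl (by simpa using hA.ne'))
  unfold HP Kfun
  refine h2.congr_deriv ?_
  simp only [Function.update_eq_self]
  rw [Real.rpow_sub hA, Real.rpow_one]
  change _ * _ * (Kfun a p / _) = FF (fun ι => a (Fin.cons k ι)) p / _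
  rw [← Kpow hA]
  have := Kpos hA
  field_simp
  ring

theorem HP_aU1 {n M : ℕ} {a : (Fin (M + 3) → Fin n) → ℝ} (hs : aSym a) (i k : Fin n)
    {p : Fin n → ℝ} (hA : 0 < Afun a p) :
    HP (aU1 a i) k ((M + 2) / Kfun a p * (aU2 a i k p - aU1 a i p * aU1 a k p)) p := by
  have hK := Kpos hA
  have h1 := HP_FF k p (M + 1) (fun ι => a (Fin.cons i ι)) (SymN.cons hs i)
  have h2 := HP_K hs k hA
  have h3 := HasDerivAt.fun_div h1 (HasDerivAt.fun_pow h2 (M + 2))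
    (by simpa using hK.ne')
  refine HasDerivAt.congr_deriv h3 ?_
  simp only [Function.update_eq_self]
  have e1 : FF (fun ι => a (Fin.cons i ι)) p = aU1 a i p * Kfun a p ^ (M + 2) := by
    unfold aU1 FF
    field_simp
  have e2 : FF (fun ι => a (Fin.cons i (Fin.cons k ι))) p = aU2 a i k p * Kfun a p ^ (M + 1) := by
    unfold aU2 FF
    field_simp
  rw [e1, e2]
  push_cast
  try simp only [Nat.add_sub_cancel, show M + 2 - 1 = M + 1 from rfl]
  field_simp
  ring

theorem HP_aU2 {n M : ℕ} {a : (Fin (M + 3) → Fin n) → ℝ} (hs : aSym a) (i j k : Fin n)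
    {p : Fin n → ℝ} (hA : 0 < Afun a p) :
    HP (aU2 a i j) k ((M + 1) / Kfun a p * (aU3 a i j k p - aU2 a i j p * aU1 a k p)) p := by
  have hK := Kpos hA
  have h1 := HP_FF k p M (fun ι => a (Fin.cons i (Fin.cons j ι))) ((SymN.cons hs i).cons j)
  have h2 := HP_K hs k hA
  have h3 := HasDerivAt.fun_div h1 (HasDerivAt.fun_pow h2 (M + 1))
    (by simpa using hK.ne')
  refine HasDerivAt.congr_deriv h3 ?_
  simp only [Function.update_eq_self]
  have e1 : FF (fun ι => a (Fin.cons i (Fin.cons j ι))) p = aU2 a i j p * Kfun a p ^ (M + 1) := by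
    unfold aU2 FF
    field_simp
  have e2 : FF (fun ι => a (Fin.cons i (Fin.cons j (Fin.cons k ι)))) p =
      aU3 a i j k p * Kfun a p ^ M := by
    unfold aU3 FF
    field_simp
  rw [e1, e2]
  push_cast
  try simp only [Nat.add_sub_cancel, show M + 2 - 1 = M + 1 from rfl]
  field_simp
  ring

theorem pd_congr {n M : ℕ} {a : (Fin (M + 3) → Fin n) → ℝ} (hs : aSym a)
    {p : Fin n → ℝ} (hA : 0 < Afun a p) (k : Fin n) {f g : (Fin n → ℝ) → ℝ}
    (hfg : ∀ q, 0 < Afun a q → f q = g q) : pd f k p = pd g k p := by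
  unfold pd
  apply Filter.EventuallyEq.deriv_eq
  have hc := HasDerivAt.continuousAt (HP_A hs k p)
  have := hc.eventually (lt_mem_nhds (by simpa using hA))
  filter_upwards [this] with t ht
  exact hfg _ ht

theorem aU2_symm {n M : ℕ} {a : (Fin (M + 3) → Fin n) → ℝ} (hs : aSym a) (i j : Fin n)
    (p : Fin n → ℝ) : aU2 a i j p = aU2 a j i p := by
  unfold aU2
  simp only [SymN.swap hs i j]

theorem aU3_symm12 {n M : ℕ} {a : (Fin (M + 3) → Fin n) → ℝ} (hs : aSym a) (i j k : Fin n)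
    (p : Fin n → ℝ) : aU3 a i j k p = aU3 a j i k p := by
  unfold aU3
  simp only [SymN.swap hs i j]

theorem aU3_symm23 {n M : ℕ} {a : (Fin (M + 3) → Fin n) → ℝ} (hs : aSym a) (i j k : Fin n)
    (p : Fin n → ℝ) : aU3 a i j k p = aU3 a i k j p := by
  unfold aU3
  simp only [SymN.swap (SymN.cons hs i) j k]

theorem gU_eq {n M : ℕ} {a : (Fin (M + 3) → Fin n) → ℝ} (hs : aSym a) (i j : Fin n)
    {p : Fin n → ℝ} (hA : 0 < Afun a p) :
    gU a i j p = (M + 2) * aU2 a i j p - (M + 1) * aU1 a i p * aU1 a j p := by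
  have hK := Kpos hA
  unfold gU
  rw [pd_congr hs hA i (g := fun q => 2 * (Kfun a q * aU1 a j q))]
  · have h := HasDerivAt.const_mul 2 (HasDerivAt.fun_mul (HP_K hs i hA) (HP_aU1 hs j i hA))
    refine Eq.trans (congrArg _ (HasDerivAt.deriv h)) ?_
    simp only [Function.update_eq_self]
    rw [aU2_symm hs j i]
    field_simp
    ring
  · intro q hq
    have h := HasDerivAt.fun_pow (HP_K hs j hq) 2
    refine Eq.trans (HasDerivAt.deriv h) ?_
    simp only [Function.update_eq_self]
    push_cast
    ring

theorem CU_eq {n M : ℕ} {a : (Fin (M + 3) → Fin n) → ℝ} (hs : aSym a) (i j k : Fin n)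
    {p : Fin n → ℝ} (hA : 0 < Afun a p) :
    CU a i j k p = -((M + 2) * (M + 1) / (2 * Kfun a p)) *
      (aU3 a i j k p - aU2 a i j p * aU1 a k p - aU2 a i k p * aU1 a j p
        - aU2 a j k p * aU1 a i p + 2 * aU1 a i p * aU1 a j p * aU1 a k p) := by
  have hK := Kpos hA
  unfold CU
  rw [pd_congr hs hA k (g := fun q => (M + 2) * aU2 a i j q - (M + 1) * (aU1 a i q * aU1 a j q))]
  · have h := HasDerivAt.fun_sub (HasDerivAt.const_mul ((M : ℝ) + 2) (HP_aU2 hs i j k hA))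
      (HasDerivAt.const_mul ((M : ℝ) + 1)
        (HasDerivAt.fun_mul (HP_aU1 hs i k hA) (HP_aU1 hs j k hA)))
    refine Eq.trans (congrArg _ (HasDerivAt.deriv h)) ?_
    simp only [Function.update_eq_self]
    field_simp
    ring
  · intro q hq
    rw [gU_eq hs i j hq]
    ring

theorem contr2 {n M : ℕ} {a : (Fin (M + 3) → Fin n) → ℝ} (i : Fin n)
    {p : Fin n → ℝ} (hA : 0 < Afun a p) :
    ∑ s, aU2 a i s p * (p s / Kfun a p) = aU1 a i p := by
  have hK := Kpos hA
  have : aU1 a i p = FF (fun ι => a (Fin.cons i ι)) p / Kfun a p ^ (M + 2) := rfl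
  rw [this, FF_succ, Finset.sum_div]
  refine Finset.sum_congr rfl fun s _ => ?_
  change FF (fun ι => a (Fin.cons i (Fin.cons s ι))) p / _ * _ = _
  field_simp
  ring

theorem contr3 {n M : ℕ} {a : (Fin (M + 3) → Fin n) → ℝ} (i j : Fin n)
    {p : Fin n → ℝ} (hA : 0 < Afun a p) :
    ∑ s, aU3 a i j s p * (p s / Kfun a p) = aU2 a i j p := by
  have hK := Kpos hA
  have : aU2 a i j p = FF (fun ι => a (Fin.cons i (Fin.cons j ι))) p / Kfun a p ^ (M + 1) := rfl
  rw [this, FF_succ, Finset.sum_div]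
  refine Finset.sum_congr rfl fun s _ => ?_
  change FF (fun ι => a (Fin.cons i (Fin.cons j (Fin.cons s ι)))) p / _ * _ = _
  field_simp
  ring

theorem contr1 {n M : ℕ} {a : (Fin (M + 3) → Fin n) → ℝ}
    {p : Fin n → ℝ} (hA : 0 < Afun a p) :
    ∑ s, aU1 a s p * (p s / Kfun a p) = 1 := by
  have hK := Kpos hA
  have h1 : Afun a p = ∑ i, p i * FF (fun ι => a (Fin.cons i ι)) p := FF_succ a p
  have h2 : Afun a p / Kfun a p ^ (M + 3) = 1 := by
    rw [Kpow hA, div_self hA.ne']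
  rw [← h2, h1, Finset.sum_div]
  refine Finset.sum_congr rfl fun s _ => ?_
  change FF (fun ι => a (Fin.cons s ι)) p / _ * _ = _
  field_simp
  ring

/-- The purely algebraic part: contraction of the torsion with itself. -/
theorem alg_part {n : ℕ} (c d e : ℝ) (L : Fin n → Fin n → ℝ) (x u1 : Fin n → ℝ)
    (u2 : Fin n → Fin n → ℝ) (u3 : Fin n → Fin n → Fin n → ℝ)
    (T : Fin n → Fin n → Fin n → ℝ)
    (hT : ∀ i j k, T i j k = u3 i j k - u2 i j * u1 k - u2 i k * u1 j - u2 j k * u1 i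
      + 2 * u1 i * u1 j * u1 k)
    (hL1 : ∀ r, ∑ s, L r s * u1 s = x r)
    (hL2 : ∀ r i, ∑ s, L r s * u2 s i = if r = i then 1 else 0)
    (hx1 : ∑ s, x s * u1 s = 1)
    (hx2 : ∀ i, ∑ s, x s * u2 s i = u1 i)
    (hx3 : ∀ i j, ∑ s, x s * u3 s i j = u2 i j)
    (hy3 : ∀ i j h : Fin n, ∑ r, (∑ s, L r s * u3 s i j) * u2 r h = u3 h i j)
    (hz3 : ∀ i j, ∑ r, (∑ s, L r s * u3 s i j) * u1 r = u2 i j)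
    (i j h k : Fin n) :
    ∑ r, (∑ s, (d * L r s + e * x r * x s) * (c * T s i j)) * (c * T r h k) =
      c ^ 2 * d * ((∑ r, (∑ s, L r s * u3 s i j) * u3 r h k)
        - u3 h i j * u1 k - u3 k i j * u1 h - u2 i j * u2 h k + 2 * u2 i j * u1 h * u1 k
        - u1 j * T i h k - u1 i * T j h k) := by
  have hxT : ∀ i j, ∑ s, x s * T s i j = 0 := by
    intro i j
    have : ∀ s, x s * T s i j = x s * u3 s i j - (x s * u2 s i) * u1 j - (x s * u2 s j) * u1 i
        - (x s * u1 s) * u2 i j + (x s * u1 s) * (2 * u1 i * u1 j) := by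
      intro s
      rw [hT]
      ring
    simp only [this, Finset.sum_add_distrib, Finset.sum_sub_distrib, ← Finset.sum_mul,
      hx1, hx2, hx3]
    ring
  have hLT : ∀ r, ∑ s, L r s * T s i j = (∑ s, L r s * u3 s i j)
      - (if r = i then 1 else 0) * u1 j - (if r = j then 1 else 0) * u1 i
      - x r * u2 i j + x r * (2 * u1 i * u1 j) := by
    intro r
    have : ∀ s, L r s * T s i j = L r s * u3 s i j - (L r s * u2 s i) * u1 j
        - (L r s * u2 s j) * u1 i
        - (L r s * u1 s) * u2 i j + (L r s * u1 s) * (2 * u1 i * u1 j) := by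
      intro s
      rw [hT]
      ring
    simp only [this, Finset.sum_add_distrib, Finset.sum_sub_distrib, ← Finset.sum_mul,
      hL1, hL2]
  have hin : ∀ r, ∑ s, (d * L r s + e * x r * x s) * (c * T s i j) =
      c * d * ∑ s, L r s * T s i j := by
    intro r
    have : ∀ s, (d * L r s + e * x r * x s) * (c * T s i j) =
        c * d * (L r s * T s i j) + (c * e * x r) * (x s * T s i j) := by
      intro s
      ring
    simp only [this, Finset.sum_add_distrib, ← Finset.mul_sum, hxT]
    ring
  have hu : ∑ r, (∑ s, L r s * u3 s i j) * T r h k =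
      (∑ r, (∑ s, L r s * u3 s i j) * u3 r h k)
        - u3 h i j * u1 k - u3 k i j * u1 h - u2 i j * u2 h k + 2 * u2 i j * u1 h * u1 k := by
    have : ∀ r, (∑ s, L r s * u3 s i j) * T r h k = (∑ s, L r s * u3 s i j) * u3 r h k
        - ((∑ s, L r s * u3 s i j) * u2 r h) * u1 k - ((∑ s, L r s * u3 s i j) * u2 r k) * u1 h
        - ((∑ s, L r s * u3 s i j) * u1 r) * u2 h k
        + ((∑ s, L r s * u3 s i j) * u1 r) * (2 * u1 h * u1 k) := by
      intro r
      rw [hT]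
      ring
    rw [Finset.sum_congr rfl fun r _ => this r]
    simp only [Finset.sum_add_distrib, Finset.sum_sub_distrib]
    rw [← Finset.sum_mul, ← Finset.sum_mul, ← Finset.sum_mul, ← Finset.sum_mul,
      hy3 i j h, hy3 i j k, hz3]
    ring
  have hfin : ∀ r, (∑ s, (d * L r s + e * x r * x s) * (c * T s i j)) * (c * T r h k) =
      c ^ 2 * d * ((∑ s, L r s * u3 s i j) * T r h k
        - ((if r = i then 1 else 0) * T r h k) * u1 j
        - ((if r = j then 1 else 0) * T r h k) * u1 i
        + (x r * T r h k) * (2 * u1 i * u1 j - u2 i j)) := by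
    intro r
    rw [hin, hLT]
    ring
  rw [Finset.sum_congr rfl fun r _ => hfin r, ← Finset.mul_sum]
  simp only [Finset.sum_add_distrib, Finset.sum_sub_distrib]
  rw [← Finset.sum_mul, ← Finset.sum_mul, ← Finset.sum_mul, hxT, hu]
  simp only [ite_mul, one_mul, zero_mul, Finset.sum_ite_eq', Finset.mem_univ, if_true]
  ring

/-- the v-curvature d-tensor satisfies
`S^{hijk} = ((m-1)(m-2)²/(4K²)) 𝒜_{j,k}{∑_r a_r^{ij}a^{rhk} - a^{ij}(a^{hk}-a^h a^k)
+ a^i a^j a^{hk}}`, where `m = M + 3`. -/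
theorem stmt_8 {n M : ℕ} (hn : 4 ≤ n) (a : (Fin (M + 3) → Fin n) → ℝ)
    (hsym : aSym a) (p : Fin n → ℝ) (hA : 0 < Afun a p)
    (aLow : Matrix (Fin n) (Fin n) ℝ)
    (hInv₁ : (Matrix.of fun i j => aU2 a i j p) * aLow = 1)
    (hInv₂ : aLow * (Matrix.of fun i j => aU2 a i j p) = 1) :
    ∀ h i j k : Fin n,
      Scurv a aLow p h i j k =
        ((M + 2 : ℝ) * (M + 1) ^ 2 / (4 * Kfun a p ^ 2)) *
          (((∑ r, aL3 a aLow p r i j * aU3 a r h k p) -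
              aU2 a i j p * (aU2 a h k p - aU1 a h p * aU1 a k p) +
              aU1 a i p * aU1 a j p * aU2 a h k p) -
            ((∑ r, aL3 a aLow p r i k * aU3 a r h j p) -
              aU2 a i k p * (aU2 a h j p - aU1 a h p * aU1 a j p) +
              aU1 a i p * aU1 a k p * aU2 a h j p)) := by
  intro h i j k
  have hK := Kpos hA
  have hL2 : ∀ r i, ∑ s, aLow r s * aU2 a s i p = if r = i then 1 else 0 := by
    intro r i
    have := congrFun (congrFun hInv₂ r) i
    simpa [Matrix.mul_apply, Matrix.one_apply] using this
  have hL2' : ∀ r i, ∑ s, aU2 a r s p * aLow s i = if r = i then 1 else 0 := by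
    intro r i
    have := congrFun (congrFun hInv₁ r) i
    simpa [Matrix.mul_apply, Matrix.one_apply] using this
  have hx : ∀ r, aL a aLow p r = p r / Kfun a p := by
    intro r
    unfold aL
    simp only [← contr2 _ hA, Finset.mul_sum]
    rw [Finset.sum_comm]
    simp only [← mul_assoc, ← Finset.sum_mul, hL2]
    simp
  have hx1 : ∑ s, aL a aLow p s * aU1 a s p = 1 := by
    rw [← contr1 hA]
    exact Finset.sum_congr rfl fun s _ => by rw [hx, mul_comm]
  have hx2 : ∀ i, ∑ s, aL a aLow p s * aU2 a s i p = aU1 a i p := by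
    intro i
    rw [← contr2 i hA]
    exact Finset.sum_congr rfl fun s _ => by rw [hx, mul_comm, aU2_symm hsym]
  have hx3 : ∀ i j, ∑ s, aL a aLow p s * aU3 a s i j p = aU2 a i j p := by
    intro i j
    rw [← contr3 i j hA]
    exact Finset.sum_congr rfl fun s _ => by
      rw [hx, mul_comm, aU3_symm12 hsym, aU3_symm23 hsym]
  have hy3 : ∀ i j h : Fin n, ∑ r, (∑ s, aLow r s * aU3 a s i j p) * aU2 a r h p =
      aU3 a h i j p := by
    intro i j h
    simp only [Finset.sum_mul]
    rw [Finset.sum_comm]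
    have : ∀ s, ∑ r, aLow r s * aU3 a s i j p * aU2 a r h p =
        (if h = s then 1 else 0) * aU3 a s i j p := by
      intro s
      rw [← hL2' h s, Finset.sum_mul]
      exact Finset.sum_congr rfl fun r _ => by rw [aU2_symm hsym h r]; ring
    simp [this]
  have hz3 : ∀ i j, ∑ r, (∑ s, aLow r s * aU3 a s i j p) * aU1 a r p = aU2 a i j p := by
    intro i j
    simp only [← contr2 _ hA, Finset.mul_sum]
    rw [Finset.sum_comm]
    simp only [← mul_assoc, ← Finset.sum_mul]
    rw [Finset.sum_congr rfl fun s _ => by rw [hy3 i j s], ← contr3 i j hA]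
    exact Finset.sum_congr rfl fun s _ => by
      rw [aU3_symm12 hsym, aU3_symm23 hsym]
  have key := fun i j h k => alg_part (-((M + 2) * (M + 1) / (2 * Kfun a p)))
    (1 / (M + 2 : ℝ)) ((M + 1 : ℝ) / (M + 2)) aLow (aL a aLow p) (fun i => aU1 a i p)
    (fun i j => aU2 a i j p) (fun i j k => aU3 a i j k p)
    (fun i j k => aU3 a i j k p - aU2 a i j p * aU1 a k p - aU2 a i k p * aU1 a j p
        - aU2 a j k p * aU1 a i p + 2 * aU1 a i p * aU1 a j p * aU1 a k p)
    (fun _ _ _ => rfl) (fun _ => rfl) hL2 hx1 hx2 hx3 hy3 hz3 i j h k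
  have hS : Scurv a aLow p h i j k = ∑ r, CL a aLow p r i j * CU a r h k p
      - ∑ r, CL a aLow p r i k * CU a r h j p := by
    unfold Scurv
    rw [Finset.sum_sub_distrib]
  rw [hS]
  unfold CL gL
  simp only [CU_eq hsym _ _ _ hA]
  rw [key i j h k, key i k h j]
  unfold aL3
  have e1 := aU3_symm12 hsym h i j p
  have e2 := aU3_symm12 hsym h i k p
  have e3 : aU3 a k i j p = aU3 a j i k p := by
    rw [aU3_symm23 hsym, aU3_symm12 hsym, aU3_symm23 hsym]
  have e4 : aU3 a j h k p = aU3 a k h j p := by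
    rw [aU3_symm23 hsym, aU3_symm12 hsym, aU3_symm23 hsym]
  rw [e1, e2, e3, e4, aU2_symm hsym k j, aU2_symm hsym k h, aU2_symm hsym j h]
  field_simp
  ring
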